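/- Let n ≥ 1 and let f be an integrable function on ℝ^n whose local maximal function M^loc f is integrable on ℝ^n. Then ∫_{ℝ^n} |f(x)| (1 + ln₊|f(x)|) dx < ∞. -/

import Mathlib

open MeasureTheory Real Set Metric ENNReal

noncomputable section

/-- `ℝ^n` with the Euclidean norm. -/
abbrev En (n : ℕ) := EuclideanSpace ℝ (Fin n)

/-- `ln₊ t = max (ln t) 0`. -/
def lnp (t : ℝ) : ℝ := max (Real.log t) 0

/-- The unit cube `Q = (-1/2, 1/2)^n`. -/
def unitQ (n : ℕ) : Set (En n) := {x | ∀ i, -(1/2 : ℝ) < x i ∧ x i < 1/2}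

/-- The dilate `φ_t(y) = t^{-n} φ(y/t)` convolved with `f` at `x`:
`(φ_t ∗ f)(x) = ∫ t^{-n} φ((x-y)/t) f(y) dy`. -/
def phiConv (n : ℕ) (φ f : En n → ℝ) (t : ℝ) (x : En n) : ℝ :=
  ∫ y, (t ^ n)⁻¹ * φ (t⁻¹ • (x - y)) * f y

/-- The maximal function `𝓜_φ f(x) = sup_{t>0} |(φ_t ∗ f)(x)|`. -/
def Mphi (n : ℕ) (φ f : En n → ℝ) (x : En n) : ℝ :=
  ⨆ t : {t : ℝ // 0 < t}, |phiConv n φ f t.1 x|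

/-- A smooth function supported in the closed unit ball with integral `1`. -/
def IsTestFun (n : ℕ) (φ : En n → ℝ) : Prop :=
  ContDiff ℝ (⊤ : ℕ∞) φ ∧ (∀ x, x ∉ Metric.closedBall (0 : En n) 1 → φ x = 0) ∧ (∫ x, φ x) = 1

/-- Membership in the Hardy space `H^1(ℝ^n)`: the maximal function `𝓜_φ f` is
integrable for every admissible `φ`. -/
def MemH1 (n : ℕ) (f : En n → ℝ) : Prop :=
  ∀ φ : En n → ℝ, IsTestFun n φ → Integrable (Mphi n φ f)

/-- The cube `Q_k = k + Q` for `k ∈ ℤ^n`. -/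
def Qk (n : ℕ) (k : Fin n → ℤ) : Set (En n) :=
  {x | ∀ i, (k i : ℝ) - 1/2 < x i ∧ x i < (k i : ℝ) + 1/2}

/-- The lattice point `k ∈ ℤ^n` viewed as a point of `ℝ^n`. -/
def zv (n : ℕ) (k : Fin n → ℤ) : En n :=
  (EuclideanSpace.equiv (Fin n) ℝ).symm (fun i => (k i : ℝ))

/-- `μ_k = ‖f_k‖_{L^1} = ∫_{Q_k} |f|`. -/
def muk (n : ℕ) (f : En n → ℝ) (k : Fin n → ℤ) : ℝ := ∫ x in Qk n k, |f x|

/-- The local Hardy–Littlewood maximal function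
`M^loc f(x) = sup_{0<r<1} r^{-n} ∫_{|y-x|<r} |f(y)| dy`. -/
def Mloc (n : ℕ) (f : En n → ℝ) (x : En n) : ℝ :=
  ⨆ r : Set.Ioo (0 : ℝ) 1, ((r : ℝ) ^ n)⁻¹ * ∫ y in Metric.ball x (r : ℝ), |f y|

lemma vol_cb (n : ℕ) (hn : 1 ≤ n) (x : En n) {r : ℝ} (hr : 0 ≤ r) :
    volume (closedBall x r) = ENNReal.ofReal (r ^ n) * volume (closedBall (0 : En n) 1) := by
  have := Measure.addHaar_closedBall' (volume : Measure (En n)) x hr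
  simpa using this

lemma ae_diff (n : ℕ) (f : En n → ℝ) (hf : Integrable f) :
    ∀ᵐ x, Filter.Tendsto (fun r => (∫⁻ y in closedBall x r, ‖f y‖ₑ) / volume (closedBall x r))
      (nhdsWithin 0 (Ioi 0)) (nhds (‖f x‖ₑ)) := by
  have h := (Besicovitch.vitaliFamily (volume : Measure (En n))).ae_tendsto_lintegral_div
    (f := fun y => ‖f y‖ₑ) hf.1.enorm hf.2.ne
  filter_upwards [h] with x hx
  exact hx.comp (Besicovitch.tendsto_filterAt volume x)

lemma setint_eq (n : ℕ) (f : En n → ℝ) (hf : Integrable f) (s : Set (En n)) :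
    ENNReal.ofReal (∫ y in s, |f y|) = ∫⁻ y in s, ‖f y‖ₑ :=
  ofReal_integral_norm_eq_lintegral_enorm hf.integrableOn

lemma ae_bdd (n : ℕ) (hn : 1 ≤ n) (f : En n → ℝ) (hf : Integrable f) :
    ∀ᵐ x, BddAbove (Set.range fun r : Set.Ioo (0 : ℝ) 1 =>
      ((r : ℝ) ^ n)⁻¹ * ∫ y in Metric.ball x (r : ℝ), |f y|) := by
  filter_upwards [ae_diff n f hf] with x hx
  set V := volume (closedBall (0 : En n) 1) with hV
  have hV0 : V ≠ 0 := (measure_closedBall_pos _ _ one_pos).ne'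
  have hVt : V ≠ ⊤ := measure_closedBall_lt_top.ne
  have h1 := hx.eventually (gt_mem_nhds (show ‖f x‖ₑ < ‖f x‖ₑ + 1 from
    ENNReal.lt_add_right (by simp) one_ne_zero))
  obtain ⟨δ, hδ, hd⟩ := (mem_nhdsGT_iff_exists_Ioo_subset).1 h1
  have hδ : 0 < δ := hδ
  refine ⟨max (((‖f x‖ₑ + 1) * V).toReal) ((δ ^ n)⁻¹ * ∫ y, |f y|), ?_⟩
  rintro _ ⟨⟨r, hr0, hr1⟩, rfl⟩
  simp only
  rcases lt_or_ge r δ with h | h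
  · refine le_max_of_le_left ?_
    have h2 : (∫⁻ y in closedBall x r, ‖f y‖ₑ) / volume (closedBall x r) < ‖f x‖ₑ + 1 := hd ⟨hr0, h⟩
    have h3 : (∫⁻ y in closedBall x r, ‖f y‖ₑ) ≤ (‖f x‖ₑ + 1) * volume (closedBall x r) := by
      refine (ENNReal.div_le_iff ?_ ?_).1 h2.le
      · exact (measure_closedBall_pos _ _ hr0).ne'
      · exact measure_closedBall_lt_top.ne
    rw [vol_cb n hn x hr0.le] at h3
    have h4 : ENNReal.ofReal (∫ y in ball x r, |f y|) ≤ ENNReal.ofReal (r ^ n) * ((‖f x‖ₑ + 1) * V) := by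
      rw [setint_eq n f hf]
      refine (lintegral_mono_set ball_subset_closedBall).trans (h3.trans (le_of_eq ?_))
      ring
    have h5 : (‖f x‖ₑ + 1) * V ≠ ⊤ := ENNReal.mul_ne_top (by simp) hVt
    rw [← ENNReal.ofReal_toReal h5, ← ENNReal.ofReal_mul (by positivity),
      ENNReal.ofReal_le_ofReal_iff (by positivity)] at h4
    rw [inv_mul_le_iff₀ (by positivity)]
    exact h4
  · refine le_max_of_le_right ?_
    refine mul_le_mul ?_ ?_ ?_ (by positivity)
    · gcongr
    · exact setIntegral_le_integral hf.abs (Filter.Eventually.of_forall fun _ => abs_nonneg _)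
    · exact integral_nonneg fun _ => abs_nonneg _

lemma weak (n : ℕ) (hn : 1 ≤ n) (f : En n → ℝ) (hf : Integrable f) (t : ℝ≥0∞)
    (ht0 : t ≠ 0) (htt : t ≠ ⊤)
    (ht : ∫⁻ y, ‖f y‖ₑ ≤ t * (ENNReal.ofReal ((1/3) ^ n) * volume (closedBall (0 : En n) 1))) :
    ∫⁻ x in {x | t < ‖f x‖ₑ}, ‖f x‖ₑ ≤ ENNReal.ofReal (5 ^ n) * (t *
      volume {y | t * (ENNReal.ofReal ((1/3) ^ n) * volume (closedBall (0 : En n) 1)) ≤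
        ENNReal.ofReal (Mloc n f y)}) := by
  set V := volume (closedBall (0 : En n) 1) with hV
  have hV0 : V ≠ 0 := (measure_closedBall_pos _ _ one_pos).ne'
  have hVt : V ≠ ⊤ := measure_closedBall_lt_top.ne
  set E : Set (En n) := {x | t < ‖f x‖ₑ ∧ Filter.Tendsto
    (fun r => (∫⁻ y in closedBall x r, ‖f y‖ₑ) / volume (closedBall x r))
      (nhdsWithin 0 (Ioi 0)) (nhds (‖f x‖ₑ))} with hE
  have key : ∀ x ∈ E, ∃ r : ℝ, 0 < r ∧ r < 1/3 ∧
      t * volume (closedBall x r) < ∫⁻ y in closedBall x r, ‖f y‖ₑ ∧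
      ∫⁻ y in closedBall x (5 * r), ‖f y‖ₑ ≤ t * volume (closedBall x (5 * r)) := by
    rintro x ⟨hx1, hx2⟩
    set S : Set ℝ := {r | 0 < r ∧ t * volume (closedBall x r) < ∫⁻ y in closedBall x r, ‖f y‖ₑ}
      with hS
    have hne : S.Nonempty := by
      have h1 := (hx2.eventually (lt_mem_nhds hx1)).and self_mem_nhdsWithin
      obtain ⟨r, hr, hr0⟩ := h1.exists
      refine ⟨r, hr0, ?_⟩
      exact (ENNReal.lt_div_iff_mul_lt (Or.inl (measure_closedBall_pos _ _ hr0).ne')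
        (Or.inl measure_closedBall_lt_top.ne)).1 hr
    have hub : ∀ r ∈ S, r < 1/3 := by
      rintro r ⟨hr0, hr⟩
      by_contra! hcon
      refine absurd (hr.trans_le ((setLIntegral_le_lintegral _ _).trans ht)) (not_lt.2 ?_)
      rw [vol_cb n hn x hr0.le]
      gcongr
    have hbdd : BddAbove S := ⟨1/3, fun r hr => (hub r hr).le⟩
    have hpos : 0 < sSup S := by
      obtain ⟨r, hr⟩ := hne
      exact hr.1.trans_le (le_csSup hbdd hr)
    obtain ⟨r, hr, hr2⟩ := exists_lt_of_lt_csSup hne (half_lt_self hpos)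
    refine ⟨r, hr.1, hub r hr, hr.2, ?_⟩
    by_contra! hcon
    have hmem : 5 * r ∈ S := ⟨by linarith [hr.1], hcon⟩
    have := le_csSup hbdd hmem
    linarith [hr.1]
  choose! r hr0 hr1 hr2 hr3 using key
  obtain ⟨u, huE, hdis, hcov⟩ := Vitali.exists_disjoint_subfamily_covering_enlargement_closedBall
    E id r (1/3) (fun a ha => (hr1 a ha).le) 5 (by norm_num)
  simp only [id] at hdis hcov
  have hucount : u.Countable := hdis.countable_of_nonempty_interior fun a ha =>
    ⟨a, ball_subset_interior_closedBall (mem_ball_self (hr0 a (huE ha)))⟩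
  have hsub1 : ({x | t < ‖f x‖ₑ} : Set (En n)) ≤ᵐ[volume] (⋃ a ∈ u, closedBall a (5 * r a) : Set (En n)) := by
    filter_upwards [ae_diff n f hf] with x hx hxt
    have hxE : x ∈ E := ⟨hxt, hx⟩
    obtain ⟨b, hb, hbs⟩ := hcov x hxE
    exact mem_biUnion hb (hbs (mem_closedBall_self (hr0 x hxE).le))
  have hsub2 : (⋃ a ∈ u, closedBall a (r a) : Set (En n)) ≤ᵐ[volume]
      ({y | t * (ENNReal.ofReal ((1/3) ^ n) * V) ≤ ENNReal.ofReal (Mloc n f y)} : Set (En n)) := by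
    filter_upwards [ae_bdd n hn f hf] with y hy hyu
    obtain ⟨a, ha, hya⟩ := mem_iUnion₂.1 hyu
    have haE := huE ha
    have hra := hr0 a haE
    have h1 := le_ciSup hy ⟨3 * r a, by linarith, by linarith [hr1 a haE]⟩
    have h1 : ((3 * r a) ^ n)⁻¹ * ∫ y in ball y (3 * r a), |f y| ≤ Mloc n f y := h1
    show _ ≤ ENNReal.ofReal (Mloc n f y)
    refine le_trans ?_ (ENNReal.ofReal_le_ofReal h1)
    rw [ENNReal.ofReal_mul (by positivity), setint_eq n f hf]
    have h2 : closedBall a (r a) ⊆ ball y (3 * r a) := by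
      intro z hz
      rw [mem_closedBall] at hz hya
      rw [mem_ball]
      have := dist_triangle_right z y a
      linarith
    calc t * (ENNReal.ofReal ((1/3) ^ n) * V)
        = ENNReal.ofReal (((3 * r a) ^ n)⁻¹) * (t * (ENNReal.ofReal ((r a) ^ n) * V)) := by
          have : ((1:ℝ)/3) ^ n = ((3 * r a) ^ n)⁻¹ * (r a) ^ n := by
            rw [mul_pow, one_div, inv_pow]; field_simp
          rw [this, ENNReal.ofReal_mul (by positivity)]; ring
      _ = ENNReal.ofReal (((3 * r a) ^ n)⁻¹) * (t * volume (closedBall a (r a))) := by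
          rw [vol_cb n hn a hra.le]
      _ ≤ _ := by
          gcongr
          exact (hr2 a haE).le.trans (lintegral_mono_set h2)
  have := hucount.to_subtype
  calc ∫⁻ x in {x | t < ‖f x‖ₑ}, ‖f x‖ₑ ≤ ∫⁻ x in ⋃ a ∈ u, closedBall a (5 * r a), ‖f x‖ₑ :=
        lintegral_mono_set' hsub1
    _ ≤ ∑' a : u, ∫⁻ x in closedBall (a : En n) (5 * r a), ‖f x‖ₑ := by
        rw [biUnion_eq_iUnion]
        exact lintegral_iUnion_le _ _
    _ ≤ ∑' a : u, ENNReal.ofReal (5 ^ n) * (t * volume (closedBall (a : En n) (r a))) := by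
        refine ENNReal.tsum_le_tsum fun a => (hr3 a (huE a.2)).trans (le_of_eq ?_)
        have h0 := hr0 a (huE a.2)
        rw [vol_cb n hn _ h0.le, vol_cb n hn _ (by linarith), mul_pow,
          ENNReal.ofReal_mul (by positivity)]
        ring
    _ = ENNReal.ofReal (5 ^ n) * (t * volume (⋃ a ∈ u, closedBall a (r a))) := by
        rw [measure_biUnion hucount hdis (fun a _ => measurableSet_closedBall),
          ENNReal.tsum_mul_left, ENNReal.tsum_mul_left]
    _ ≤ _ := by
        gcongr 2
        exact measure_mono_ae hsub2

lemma geo (L : ℝ≥0∞) (c M : ℝ≥0∞) (N : ℕ) :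
    ∑ k ∈ Finset.range N, (if L * 2 ^ k * c ≤ M then L * 2 ^ k * c else 0) ≤ min (2 * M) (L * 2 ^ N * c) := by
  induction N with
  | zero => simp
  | succ N ih =>
    rw [Finset.sum_range_succ]
    have e : L * 2 ^ (N + 1) * c = 2 * (L * 2 ^ N * c) := by ring
    rw [e]
    rw [le_min_iff] at ih ⊢
    split_ifs with h
    · have h2 : ∑ k ∈ Finset.range N, (if L * 2 ^ k * c ≤ M then L * 2 ^ k * c else 0) + L * 2 ^ N * c ≤ 2 * (L * 2 ^ N * c) := by
        rw [two_mul]; gcongr; exact ih.2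
      exact ⟨h2.trans (by gcongr), h2⟩
    · rw [add_zero]
      refine ⟨ih.1, ih.2.trans ?_⟩
      rw [two_mul]; exact le_self_add

lemma logbound (L : ℝ) (hL : 1 ≤ L) (a : ℝ) :
    ENNReal.ofReal (|a| * (1 + lnp |a|)) ≤ ENNReal.ofReal (1 + Real.log L) * ‖a‖ₑ +
      ∑' k : ℕ, (if ENNReal.ofReal L * 2 ^ k < ‖a‖ₑ then ‖a‖ₑ else 0) := by
  have hlL := Real.log_nonneg hL
  have hen : ‖a‖ₑ = ENNReal.ofReal |a| := (Real.enorm_eq_ofReal_abs a)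
  rcases le_or_gt |a| L with h | h
  · refine le_add_right ?_
    rw [hen, ← ENNReal.ofReal_mul (by linarith), mul_comm]
    gcongr
    unfold lnp
    refine max_le ?_ hlL
    rcases eq_or_lt_of_le (abs_nonneg a) with h0 | h0
    · rw [← h0]; simpa using hlL
    · exact Real.log_le_log h0 h
  · have ha : 0 < |a| := by linarith
    set N := ⌈Real.log (|a| / L)⌉₊ with hN
    have h1 : ENNReal.ofReal (|a| * N) ≤ ∑' k : ℕ, (if ENNReal.ofReal L * 2 ^ k < ‖a‖ₑ then ‖a‖ₑ else 0) := by
      refine le_trans (le_of_eq ?_) (ENNReal.sum_le_tsum (Finset.range N))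
      rw [Finset.sum_congr rfl (g := fun _ => ‖a‖ₑ)]
      · rw [Finset.sum_const, Finset.card_range, nsmul_eq_mul, hen, mul_comm, ENNReal.ofReal_mul (by positivity)]
        simp
      · intro k hk
        rw [if_pos]
        have hk := Nat.lt_ceil.1 (Finset.mem_range.1 hk)
        rw [Real.lt_log_iff_exp_lt (by positivity), lt_div_iff₀ (by linarith)] at hk
        have h2 : (2:ℝ) ^ k ≤ Real.exp k := by
          rw [← Real.exp_one_pow]
          have := Real.add_one_le_exp 1
          gcongr; linarith
        rw [hen, show (2:ℝ≥0∞) ^ k = ENNReal.ofReal (2 ^ k) by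
          rw [ENNReal.ofReal_pow (by norm_num)]; simp, ← ENNReal.ofReal_mul (by linarith),
          ENNReal.ofReal_lt_ofReal_iff ha]
        nlinarith
    refine le_trans ?_ (add_le_add_right h1 _)
    rw [hen, ← ENNReal.ofReal_mul (by linarith), ← ENNReal.ofReal_add (by positivity) (by positivity)]
    gcongr
    have h3 := Nat.le_ceil (Real.log (|a| / L))
    rw [← hN, Real.log_div ha.ne' (by linarith)] at h3
    have h4 : lnp |a| ≤ Real.log L + N := max_le (by linarith) (by positivity)
    nlinarith

/-- If `f` is integrable and its local maximal function `M^loc f` is integrable,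
then `∫ |f(x)| (1 + ln₊|f(x)|) dx < ∞`. -/
theorem LlogL_necessary (n : ℕ) (hn : 1 ≤ n) (f : En n → ℝ)
    (hf : Integrable f) (hM : Integrable (Mloc n f)) :
    ∫⁻ x, ENNReal.ofReal (|f x| * (1 + lnp |f x|)) < ⊤ := by
  set V := volume (closedBall (0 : En n) 1) with hV
  have hV0 : V ≠ 0 := (measure_closedBall_pos _ _ one_pos).ne'
  have hVt : V ≠ ⊤ := measure_closedBall_lt_top.ne
  set c := ENNReal.ofReal ((1/3) ^ n) * V with hc
  have hc0 : c ≠ 0 := mul_ne_zero (by simp) hV0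
  have hct : c ≠ ⊤ := ENNReal.mul_ne_top (by simp) hVt
  have hft : ∫⁻ y, ‖f y‖ₑ ≠ ⊤ := hf.2.ne
  have hqt : (∫⁻ y, ‖f y‖ₑ) / c ≠ ⊤ := ENNReal.div_ne_top hft hc0
  set L : ℝ := max 1 ((∫⁻ y, ‖f y‖ₑ) / c).toReal with hLd
  have hL : 1 ≤ L := le_max_left _ _
  set T : ℝ≥0∞ := ENNReal.ofReal L with hT
  have hT1 : 1 ≤ T := by rw [hT]; simpa using hL
  have hTt : T ≠ ⊤ := ENNReal.ofReal_ne_top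
  have hTc : ∫⁻ y, ‖f y‖ₑ ≤ T * c := by
    rw [← ENNReal.div_le_iff hc0 hct, ← ENNReal.ofReal_toReal hqt]
    exact ENNReal.ofReal_le_ofReal (le_max_right _ _)
  have hmf : AEMeasurable (fun x => ‖f x‖ₑ) := hf.1.enorm
  have hmM : AEMeasurable (fun x => ENNReal.ofReal (Mloc n f x)) := hM.1.aemeasurable.ennreal_ofReal
  have hs1 : ∀ k : ℕ, NullMeasurableSet {x | T * 2 ^ k < ‖f x‖ₑ} := fun k =>
    nullMeasurableSet_lt aemeasurable_const hmf
  have hs2 : ∀ k : ℕ, NullMeasurableSet {x | T * 2 ^ k * c ≤ ENNReal.ofReal (Mloc n f x)} :=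
    fun k => nullMeasurableSet_le aemeasurable_const hmM
  have hMt : ∫⁻ x, ENNReal.ofReal (Mloc n f x) < ⊤ := hM.lintegral_lt_top
  have hw : ∀ k : ℕ, ∫⁻ x in {x | T * 2 ^ k < ‖f x‖ₑ}, ‖f x‖ₑ ≤ ENNReal.ofReal (5 ^ n) *
      (T * 2 ^ k * volume {y | T * 2 ^ k * c ≤ ENNReal.ofReal (Mloc n f y)}) := by
    intro k
    refine weak n hn f hf (T * 2 ^ k) ?_ ?_ ?_
    · exact mul_ne_zero (one_pos.trans_le hT1).ne' (by simp)
    · exact ENNReal.mul_ne_top hTt (by simp)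
    · refine hTc.trans ?_
      change T * c ≤ T * 2 ^ k * c
      gcongr
      exact le_mul_of_one_le_right' (one_le_pow₀ (by norm_num))
  have hsum : c * ∑' k : ℕ, ∫⁻ x in {x | T * 2 ^ k < ‖f x‖ₑ}, ‖f x‖ₑ < ⊤ := by
    calc c * ∑' k : ℕ, ∫⁻ x in {x | T * 2 ^ k < ‖f x‖ₑ}, ‖f x‖ₑ
        ≤ c * ∑' k : ℕ, ENNReal.ofReal (5 ^ n) *
          (T * 2 ^ k * volume {y | T * 2 ^ k * c ≤ ENNReal.ofReal (Mloc n f y)}) := by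
          gcongr with k
          exact hw k
      _ = ENNReal.ofReal (5 ^ n) * ∑' k : ℕ, (T * 2 ^ k * c) * volume
          {y | T * 2 ^ k * c ≤ ENNReal.ofReal (Mloc n f y)} := by
          rw [ENNReal.tsum_mul_left, mul_left_comm, ← ENNReal.tsum_mul_left]
          congr 2
          ext k
          ring
      _ = ENNReal.ofReal (5 ^ n) * ∑' k : ℕ, ∫⁻ y,
          {y | T * 2 ^ k * c ≤ ENNReal.ofReal (Mloc n f y)}.indicator (fun _ => T * 2 ^ k * c) y := by
          congr 2
          ext k
          rw [lintegral_indicator_const₀ (hs2 k)]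
      _ = ENNReal.ofReal (5 ^ n) * ∫⁻ y, ∑' k : ℕ,
          {y | T * 2 ^ k * c ≤ ENNReal.ofReal (Mloc n f y)}.indicator (fun _ => T * 2 ^ k * c) y := by
          rw [lintegral_tsum fun k => aemeasurable_const.indicator₀ (hs2 k)]
      _ ≤ ENNReal.ofReal (5 ^ n) * ∫⁻ y, 2 * ENNReal.ofReal (Mloc n f y) := by
          gcongr with y
          refine ENNReal.tsum_le_of_sum_range_le fun N => ?_
          have := (geo T c (ENNReal.ofReal (Mloc n f y)) N).trans (min_le_left _ _)
          simpa only [Set.indicator_apply, Set.mem_ofPred_eq] using this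
      _ < ⊤ := by
          rw [lintegral_const_mul' _ _ (by simp)]
          exact ENNReal.mul_lt_top (by simp) (ENNReal.mul_lt_top (by simp) hMt)
  have hsum' : ∑' k : ℕ, ∫⁻ x in {x | T * 2 ^ k < ‖f x‖ₑ}, ‖f x‖ₑ < ⊤ := by
    rw [lt_top_iff_ne_top]
    intro h
    rw [h, ENNReal.mul_top hc0] at hsum
    exact lt_irrefl _ hsum
  calc ∫⁻ x, ENNReal.ofReal (|f x| * (1 + lnp |f x|))
      ≤ ∫⁻ x, (ENNReal.ofReal (1 + Real.log L) * ‖f x‖ₑ +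
        ∑' k : ℕ, {x | T * 2 ^ k < ‖f x‖ₑ}.indicator (fun x => ‖f x‖ₑ) x) := by
        refine lintegral_mono fun x => ?_
        have := logbound L hL (f x)
        simpa only [Set.indicator_apply, Set.mem_ofPred_eq] using this
    _ = ENNReal.ofReal (1 + Real.log L) * (∫⁻ x, ‖f x‖ₑ) +
        ∑' k : ℕ, ∫⁻ x in {x | T * 2 ^ k < ‖f x‖ₑ}, ‖f x‖ₑ := by
        rw [lintegral_add_left' (hmf.const_mul _), lintegral_const_mul' _ _ (by simp),
          lintegral_tsum fun k => hmf.indicator₀ (hs1 k)]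
        congr 1
        refine tsum_congr fun k => ?_
        rw [lintegral_indicator₀ (hs1 k)]
    _ < ⊤ := ENNReal.add_lt_top.2 ⟨ENNReal.mul_lt_top ENNReal.ofReal_lt_top hf.2, hsum'⟩
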